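/- Let M ≥ 2 and let D̃ be the set of all strings x^n ∈ A^* such that |T_u(T(x^n))| ≥ M for every u ∈ A^{k+1}, and no proper prefix of x^n has this property (so D̃ is a complete prefix-free dictionary). Then for every x ∈ D̃, the number of dictionary strings of the same type as x satisfies |D̃ ∩ T(x)| ≥ M. -/

import Mathlib

open Finset

/-- `Finset.filter` with classical decidability. -/
noncomputable def sfilter {α : Type*} (p : α → Prop) (s : Finset α) : Finset α :=
  @Finset.filter α p (Classical.decPred p) s

/-- The finset of all strings of length `n` over the alphabet `A`. -/
def lists (A : Type*) [Fintype A] [DecidableEq A] : ℕ → Finset (List A)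
  | 0 => {[]}
  | n + 1 => Finset.image₂ List.cons Finset.univ (lists A n)

/-- Symbol at (0-indexed) integer position `j` of the string `x`, where negative
positions `-k, …, -1` are given by the fixed initial state `s0`. -/
def symL {A : Type*} [Inhabited A] (k : ℕ) (s0 : Fin k → A) (x : List A) (j : ℤ) : A :=
  if h : 0 ≤ j then
    (if h2 : j.toNat < x.length then x.get ⟨j.toNat, h2⟩ else default)
  else
    (if h3 : (j + k).toNat < k then s0 ⟨(j + k).toNat, h3⟩ else default)

/-- The state (context of order `k`) preceding position `t` of the string `x`. -/
def ctxL {A : Type*} [Inhabited A] (k : ℕ) (s0 : Fin k → A) (x : List A)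
    (t : ℕ) : Fin k → A :=
  fun i => symL k s0 x ((t : ℤ) - (k : ℤ) + (i : ℤ))

/-- `n_{sa}(x)`: number of occurrences of symbol `a` in state `s` within `x`. -/
noncomputable def countL {A : Type*} [Inhabited A] [DecidableEq A] (k : ℕ)
    (s0 : Fin k → A) (s : Fin k → A) (a : A) (x : List A) : ℕ :=
  (sfilter (fun t : Fin x.length => ctxL k s0 x t = s ∧ x.get t = a) Finset.univ).card

/-- Two strings have the same `k`-th order type. -/
def sameTypeL {A : Type*} [Inhabited A] [DecidableEq A] (k : ℕ) (s0 : Fin k → A)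
    (x y : List A) : Prop :=
  x.length = y.length ∧
    ∀ (s : Fin k → A) (a : A), countL k s0 s a x = countL k s0 s a y

/-- The type class `T(x)` as a finset of strings of length `|x|`. -/
noncomputable def typeClassL {A : Type*} [Fintype A] [DecidableEq A] [Inhabited A]
    (k : ℕ) (s0 : Fin k → A) (x : List A) : Finset (List A) :=
  sfilter (fun y => sameTypeL k s0 x y) (lists A x.length)

/-- Probability `P(x) = ∏_t p(x_t | state)` of the string `x`. -/
noncomputable def seqProbL {A : Type*} [Inhabited A] (k : ℕ) (s0 : Fin k → A)
    (p : (Fin k → A) → A → ℝ) (x : List A) : ℝ :=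
  ∏ t : Fin x.length, p (ctxL k s0 x t) (x.get t)

/-- `p` is a (strictly positive) `k`-th order Markov kernel. -/
def IsMarkov {A : Type*} [Fintype A] (k : ℕ) (p : (Fin k → A) → A → ℝ) : Prop :=
  (∀ s a, 0 < p s a) ∧ ∀ s, ∑ a : A, p s a = 1

/-- A prefix-free set of strings. -/
def PrefixFree {A : Type*} (D : Set (List A)) : Prop :=
  ∀ x ∈ D, ∀ y ∈ D, x <+: y → x = y

/-- A complete dictionary: prefix-free, and every string either has a prefix in `D`
or is a prefix of a string in `D`. -/
def CompleteDict {A : Type*} (D : Set (List A)) : Prop :=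
  PrefixFree D ∧ ∀ z : List A, (∃ x ∈ D, x <+: z) ∨ (∃ y ∈ D, z <+: y)

/-- `D ∩ A^n` as a finset. -/
noncomputable def dictAt {A : Type*} [Fintype A] [DecidableEq A]
    (D : Set (List A)) (n : ℕ) : Finset (List A) :=
  sfilter (fun x => x ∈ D) (lists A n)

/-- The failure set at level `n`: strings of length `n` with no prefix in `D`. -/
noncomputable def failAt {A : Type*} [Fintype A] [DecidableEq A]
    (D : Set (List A)) (n : ℕ) : Finset (List A) :=
  sfilter (fun x => ¬ ∃ y ∈ D, y <+: x) (lists A n)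

/-- The failure part of a finite set `T` of strings: members with no prefix in `D`. -/
noncomputable def failIn {A : Type*} (D : Set (List A)) (T : Finset (List A)) :
    Finset (List A) :=
  sfilter (fun x => ¬ ∃ y ∈ D, y <+: x) T

/-- The VFR `(D, ξ, M)` is perfect for the process `p` (at every level `n`,
equivalently at every truncation level): conditioned on `X^n ∈ D ∩ A^n`
(whenever nonempty), `ξ(X^n)` is uniform on `{0, …, M−1}`. -/
def PerfectVFR {A : Type*} [Fintype A] [DecidableEq A] [Inhabited A] (k : ℕ)
    (s0 : Fin k → A) (p : (Fin k → A) → A → ℝ) (D : Set (List A))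
    (ξ : List A → ℕ) (M : ℕ) : Prop :=
  ∀ n : ℕ, (dictAt (A := A) D n).Nonempty →
    ∀ r < M,
      (∑ x ∈ sfilter (fun x => ξ x = r) (dictAt (A := A) D n), seqProbL k s0 p x)
        = (∑ x ∈ dictAt (A := A) D n, seqProbL k s0 p x) / (M : ℝ)

/-- `T_u(T)`: the prefixes of length `n − ℓ` of the members `z` of `T` (strings of
length `n`) whose symbols at positions `n−k−ℓ+1, …, n−k` (1-indexed, with the
initial-state convention for nonpositive indices) form the string `u` (of length `ℓ`). -/
noncomputable def TcutSet {A : Type*} [DecidableEq A] [Inhabited A] (k : ℕ) (s0 : Fin k → A)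
    (T : Finset (List A)) (u : List A) : Finset (List A) :=
  Finset.image (fun z => z.take (z.length - u.length))
    (sfilter (fun z => u.length ≤ z.length ∧
      ∀ i : Fin u.length,
        symL k s0 z ((z.length : ℤ) - (k : ℤ) - (u.length : ℤ) + (i : ℤ)) = u.get i) T)

/-- The membership condition defining `D̃`: every cut `T_u(T(x))`, `u ∈ A^{k+1}`,
of the type class of `x` has at least `M` elements. -/
def BigType {A : Type*} [Fintype A] [DecidableEq A] [Inhabited A] (k : ℕ)
    (s0 : Fin k → A) (M : ℕ) (x : List A) : Prop :=
  ∀ u : List A, u.length = k + 1 →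
    M ≤ (TcutSet k s0 (typeClassL k s0 x) u).card

/-- The auxiliary dictionary `D̃`: strings satisfying the membership condition none
of whose proper prefixes satisfies it. -/
def Dtilde {A : Type*} [Fintype A] [DecidableEq A] [Inhabited A] (k : ℕ)
    (s0 : Fin k → A) (M : ℕ) : Set (List A) :=
  {x | BigType k s0 M x ∧ ∀ y : List A, y <+: x → y ≠ x → ¬ BigType k s0 M y}

section Walks

variable {A : Type*} {k : ℕ}

/-- The state reached from `s` after reading the symbol `a`. -/
def stepState (s : Fin k → A) (a : A) : Fin k → A :=
  fun i => if h : (i : ℕ) + 1 < k then s ⟨i + 1, h⟩ else a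

/-- The state reached from `s` after reading the string `l`. -/
def runState (s : Fin k → A) (l : List A) : Fin k → A :=
  l.foldl stepState s

/-- The sequence of (state, symbol) transitions made when reading `l` from the state `s`. -/
def walk (s : Fin k → A) : List A → List ((Fin k → A) × A)
  | [] => []
  | a :: l => (s, a) :: walk (stepState s a) l

@[simp] theorem runState_nil (s : Fin k → A) : runState s [] = s := rfl

@[simp] theorem runState_cons (s : Fin k → A) (a : A) (l : List A) :
    runState s (a :: l) = runState (stepState s a) l := rfl

@[simp] theorem runState_append (s : Fin k → A) (l l' : List A) :
    runState s (l ++ l') = runState (runState s l) l' := by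
  simp [runState]

@[simp] theorem walk_nil (s : Fin k → A) : walk s [] = [] := rfl

@[simp] theorem walk_cons (s : Fin k → A) (a : A) (l : List A) :
    walk s (a :: l) = (s, a) :: walk (stepState s a) l := rfl

@[simp] theorem walk_append (s : Fin k → A) (l l' : List A) :
    walk s (l ++ l') = walk s l ++ walk (runState s l) l' := by
  induction l generalizing s with
  | nil => rfl
  | cons a l ih => simp [ih]

@[simp] theorem length_walk (s : Fin k → A) (l : List A) : (walk s l).length = l.length := by
  induction l generalizing s with
  | nil => rfl
  | cons a l ih => simp [ih]

theorem mem_walk {s q : Fin k → A} {b : A} {l : List A} (h : (q, b) ∈ walk s l) :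
    ∃ l₁ l₂, l = l₁ ++ b :: l₂ ∧ runState s l₁ = q := by
  induction l generalizing s with
  | nil => simp at h
  | cons a l ih =>
    rcases List.mem_cons.1 h with h | h
    · obtain ⟨rfl, rfl⟩ := Prod.mk.inj h
      exact ⟨[], l, rfl, rfl⟩
    · obtain ⟨l₁, l₂, rfl, hq⟩ := ih h
      exact ⟨a :: l₁, l₂, rfl, hq⟩

theorem states_walk (s : Fin k → A) (l : List A) :
    (walk s l).map Prod.fst ++ [runState s l] =
      s :: (walk s l).map (fun e => stepState e.1 e.2) := by
  induction l generalizing s with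
  | nil => rfl
  | cons a l ih => simpa using ih (stepState s a)

theorem runState_eq_of_perm {s : Fin k → A} {x y : List A}
    (h : (walk s x).Perm (walk s y)) : runState s x = runState s y := by
  have h1 : ((walk s x).map Prod.fst ++ [runState s x]).Perm
      ((walk s y).map Prod.fst ++ [runState s y]) := by
    rw [states_walk, states_walk]
    exact (h.map _).cons _
  have h2 := ((h.map Prod.fst).append_right [runState s x]).symm.trans h1
  simpa using (List.perm_append_left_iff _).1 h2

theorem walk_append_perm {s : Fin k → A} {x y : List A} (h : (walk s x).Perm (walk s y))
    (w : List A) : (walk s (x ++ w)).Perm (walk s (y ++ w)) := by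
  rw [walk_append, walk_append, runState_eq_of_perm h]
  exact h.append_right _

/-- Reading `y` from `s` passes through the state `q`. -/
def Visits (s q : Fin k → A) (y : List A) : Prop :=
  q ∈ (walk s y).map Prod.fst ++ [runState s y]

theorem Visits.of_perm {s q : Fin k → A} {x y : List A} (h : (walk s x).Perm (walk s y))
    (hx : Visits s q x) : Visits s q y := by
  rw [Visits, ← runState_eq_of_perm h]
  exact ((h.map _).append_right _).subset hx

theorem visits_start (s : Fin k → A) (y : List A) : Visits s s y := by
  rw [Visits, states_walk]
  simp

/-- Insert the string `L` in `y` at the first visit of `q` when reading `y` from `s`. -/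
noncomputable def insertLoop (q : Fin k → A) (L : List A) (s : Fin k → A) : List A → List A
  | [] => open Classical in if s = q then L else []
  | a :: y => open Classical in
      if s = q then L ++ a :: y else a :: insertLoop q L (stepState s a) y

theorem insertLoop_eq (q : Fin k → A) (L y : List A) : insertLoop q L q y = L ++ y := by
  cases y <;> simp [insertLoop]

theorem insertLoop_injective (q : Fin k → A) (L : List A) (s : Fin k → A) :
    Function.Injective (insertLoop q L s) := by
  intro y
  induction y generalizing s with
  | nil =>
    intro y' h
    by_cases hs : s = q
    · subst hs
      simpa [insertLoop_eq] using h
    · cases y' <;> simp_all [insertLoop]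
  | cons a y ih =>
    intro y' h
    by_cases hs : s = q
    · subst hs
      simpa [insertLoop_eq] using h
    · cases y' with
      | nil => simp_all [insertLoop]
      | cons b y' =>
        simp only [insertLoop, hs, if_false, List.cons.injEq] at h
        obtain ⟨rfl, h⟩ := h
        rw [ih _ h]

theorem insertLoop_spec {q : Fin k → A} {L : List A} (hL : runState q L = q)
    {s : Fin k → A} {y : List A} (hy : Visits s q y) :
    runState s (insertLoop q L s y) = runState s y ∧
      (walk s (insertLoop q L s y)).Perm (walk s y ++ walk q L) := by
  induction y generalizing s with
  | nil =>
    obtain rfl : q = s := by simpa [Visits] using hy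
    simp [insertLoop, hL]
  | cons a y ih =>
    by_cases hs : s = q
    · subst hs
      rw [insertLoop_eq, runState_append, walk_append, hL]
      exact ⟨rfl, List.perm_append_comm⟩
    · have hv : Visits (stepState s a) q y := by
        have := hy
        simp only [Visits, walk_cons, List.map_cons, List.cons_append, List.mem_cons,
          runState_cons] at this
        exact this.resolve_left (Ne.symm hs)
      obtain ⟨h1, h2⟩ := ih hv
      simp only [insertLoop, hs, if_false, runState_cons, walk_cons, List.cons_append]
      exact ⟨h1, h2.cons _⟩

theorem walk_flatten_perm {q : Fin k → A} {Ls Ls' : List (List A)} (h : Ls.Perm Ls')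
    (hL : ∀ l ∈ Ls, runState q l = q) :
    (walk q Ls.flatten).Perm (walk q Ls'.flatten) := by
  have key : ∀ Ls : List (List A), (∀ l ∈ Ls, runState q l = q) →
      walk q Ls.flatten = (Ls.map (walk q)).flatten := by
    intro Ls
    induction Ls with
    | nil => simp
    | cons l Ls ih =>
      intro h
      simp only [List.mem_cons, forall_eq_or_imp] at h
      simp [h.1, ih h.2]
  rw [key _ hL, key _ fun l hl => hL l (h.mem_iff.2 hl)]
  exact (h.map _).flatten

theorem runState_flatten {q : Fin k → A} {Ls : List (List A)}
    (hL : ∀ l ∈ Ls, runState q l = q) : runState q Ls.flatten = q := by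
  induction Ls with
  | nil => rfl
  | cons l Ls ih =>
    simp only [List.mem_cons, forall_eq_or_imp] at hL
    simp [hL.1, ih hL.2]

theorem replicate_append_cons_inj {o b : A} (hb : b ≠ o) {i j : ℕ} {l l' : List A}
    (h : List.replicate i o ++ b :: l = List.replicate j o ++ b :: l') : i = j := by
  induction i generalizing j with
  | zero =>
    cases j with
    | zero => rfl
    | succ j => exact absurd (by simpa [List.replicate_succ] using (List.cons.inj h).1) hb
  | succ i ih =>
    cases j with
    | zero => exact absurd (by simpa [List.replicate_succ] using (List.cons.inj h).1.symm) hb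
    | succ j => rw [ih (j := j) (by simpa [List.replicate_succ] using h)]

end Walks

section Symbols

variable {A : Type*} [Inhabited A] {k : ℕ} (s0 : Fin k → A)

theorem symL_natCast {x : List A} {t : ℕ} (ht : t < x.length) :
    symL k s0 x (t : ℤ) = x[t] := by
  simp [symL, ht]

theorem ctxL_zero (x : List A) : ctxL k s0 x 0 = s0 := by
  funext i
  have h : ¬ (0 : ℤ) ≤ ((0 : ℕ) : ℤ) - k + i := by omega
  have h' : (((0 : ℕ) : ℤ) - k + i + k).toNat = i := by omega
  simp only [ctxL, symL, h, dif_neg, not_false_eq_true, h']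
  simp

theorem ctxL_succ {x : List A} {t : ℕ} (ht : t < x.length) :
    ctxL k s0 x (t + 1) = stepState (ctxL k s0 x t) x[t] := by
  funext i
  unfold stepState
  split_ifs with h
  · simp only [ctxL]
    congr 1
    push_cast
    ring
  · have : ((t + 1 : ℕ) : ℤ) - k + i = t := by omega
    simp only [ctxL, this]
    exact symL_natCast s0 ht

theorem ctxL_eq_runState {x : List A} {t : ℕ} (ht : t ≤ x.length) :
    ctxL k s0 x t = runState s0 (x.take t) := by
  induction t with
  | zero => simp [ctxL_zero]
  | succ t ih =>
    rw [ctxL_succ s0 ht, ih (by omega), List.take_succ_eq_append_getElem ht, runState_append]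
    rfl

theorem runState_ofFn (g : Fin k → A) : runState s0 (List.ofFn g) = g := by
  have h := ctxL_eq_runState s0 (x := List.ofFn g) le_rfl
  rw [List.take_length] at h
  rw [← h]
  funext i
  have : (((List.ofFn g).length : ℕ) : ℤ) - k + i = ((i : ℕ) : ℤ) := by simp
  rw [ctxL, this, symL_natCast s0 (by simp)]
  simp

theorem walk_eq_ofFn (x : List A) :
    walk s0 x = List.ofFn fun t : Fin x.length => (ctxL k s0 x t, x.get t) := by
  have key : ∀ (s : Fin k → A) (l : List A) (t : ℕ) (ht : t < l.length),
      (walk s l)[t]'(by simpa using ht) = (runState s (l.take t), l[t]) := by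
    intro s l
    induction l generalizing s with
    | nil => simp
    | cons a l ih =>
      intro t ht
      cases t with
      | zero => simp
      | succ t => simpa using ih (stepState s a) t (by simpa using ht)
  apply List.ext_getElem
  · simp
  · intro t h1 h2
    have ht : t < x.length := by simpa using h1
    rw [key s0 x t ht]
    simp [ctxL_eq_runState s0 ht.le]

theorem countL_eq_count [DecidableEq A] (s : Fin k → A) (a : A) (x : List A) :
    countL k s0 s a x = (walk s0 x).count (s, a) := by
  rw [walk_eq_ofFn, List.ofFn_eq_map, List.count, List.countP_map, countL, sfilter,
    Finset.card_def, Finset.filter_val, ← Multiset.countP_eq_card_filter, Fin.univ_def,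
    Multiset.coe_countP]
  exact List.countP_congr (by simp)

theorem sameTypeL_iff [DecidableEq A] (x y : List A) :
    sameTypeL k s0 x y ↔ (walk s0 x).Perm (walk s0 y) := by
  constructor
  · intro h
    rw [List.perm_iff_count]
    rintro ⟨s, a⟩
    simpa only [countL_eq_count] using h.2 s a
  · intro h
    refine ⟨by simpa using h.length_eq, fun s a => ?_⟩
    simpa only [countL_eq_count] using h.count_eq (s, a)

end Symbols

theorem mem_sfilter {α : Type*} {p : α → Prop} {s : Finset α} {x : α} :
    x ∈ sfilter p s ↔ x ∈ s ∧ p x := by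
  simp [sfilter]

section Splitting

variable {A : Type*} [Inhabited A] {k : ℕ} {s0 : Fin k → A}

theorem exists_split_of_length_le {z : List A} (hz : k + 1 ≤ z.length) :
    ∃ y b, z = y ++ b :: List.ofFn (runState s0 z) ∧ y = z.take (z.length - (k + 1)) := by
  have hd : (z.drop (z.length - (k + 1))).length = k + 1 := by
    rw [List.length_drop]
    omega
  obtain ⟨b, g, hg⟩ := List.exists_cons_of_length_eq_add_one hd
  have hgk : g.length = k := by simpa [hg] using hd
  have hz' : z = z.take (z.length - (k + 1)) ++ b :: g := by
    rw [← hg, List.take_append_drop]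
  obtain ⟨g', rfl⟩ : ∃ g' : Fin k → A, List.ofFn g' = g := by
    subst hgk
    exact ⟨g.get, List.ofFn_get g⟩
  refine ⟨_, b, ?_, rfl⟩
  have hr : runState s0 z = g' := by
    rw [hz', runState_append, runState_cons, runState_ofFn]
  rw [hr]
  exact hz'

theorem cut_condition_iff (y g : List A) (hg : g.length = k) (b c : A) (σ : Fin k → A) :
    (∀ i : Fin (List.ofFn σ ++ [b]).length,
      symL k s0 (y ++ c :: g) (((y ++ c :: g).length : ℤ) - (k : ℤ)
        - ((List.ofFn σ ++ [b]).length : ℤ) + (i : ℤ)) = (List.ofFn σ ++ [b]).get i) ↔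
      runState s0 y = σ ∧ c = b := by
  have hstate : runState s0 y = ctxL k s0 (y ++ c :: g) y.length := by
    rw [ctxL_eq_runState s0 (by simp), List.take_left]
  have hsym : symL k s0 (y ++ c :: g) (y.length : ℤ) = c := by
    rw [symL_natCast s0 (by simp)]
    simp
  rw [hstate]
  constructor
  · intro h
    constructor
    · funext i
      have := h ⟨i, by simp⟩
      simp only [List.get_eq_getElem, List.getElem_append_left, List.length_ofFn, Fin.is_lt,
        List.getElem_ofFn] at this
      rw [← this, ctxL]
      congr 1
      simp [hg]
      ring
    · have := h ⟨k, by simp⟩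
      simp only [List.get_eq_getElem, List.length_ofFn, le_refl, List.getElem_append_right,
        Nat.sub_self, List.getElem_cons_zero] at this
      refine hsym.symm.trans (Eq.trans ?_ this)
      congr 1
      simp [hg]
      ring
  · rintro ⟨h1, rfl⟩ ⟨i, hi⟩
    have hi' : i < k + 1 := by simpa using hi
    rcases Nat.lt_succ_iff_lt_or_eq.1 hi' with h | h
    · simp only [List.get_eq_getElem, List.length_ofFn, h, List.getElem_append_left,
        List.getElem_ofFn]
      rw [← h1, ctxL]
      congr 1
      simp [hg]
      ring
    · subst h
      simp only [List.get_eq_getElem, List.length_ofFn, le_refl, List.getElem_append_right,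
        Nat.sub_self, List.getElem_cons_zero]
      convert hsym using 2
      simp [hg]
      ring

/-- If every transition occurs in the walk along `y ++ a :: G`, then reading `y` passes through
one of the states met while reading the final part `G`. -/
theorem exists_visits_of_forall_mem_walk {y G : List A} {a : A}
    (h : ∀ σ b, (σ, b) ∈ walk s0 (y ++ a :: G)) :
    ∃ c₁ c₂, G = c₁ ++ c₂ ∧
      Visits s0 (runState (stepState (runState s0 y) a) c₁) y := by
  set f := stepState (runState s0 y) a with hf
  by_contra! hno
  have key : ∀ l : List A, ∃ c₁ c₂, G = c₁ ++ c₂ ∧ runState f c₁ = runState f l := by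
    intro l
    induction l using List.reverseRecOn with
    | nil => exact ⟨[], G, rfl, rfl⟩
    | append_singleton l b ih =>
      obtain ⟨c₁, c₂, hG, hc⟩ := ih
      have hnv := hno c₁ c₂ hG
      have hmem := h (runState f c₁) b
      rw [walk_append, walk_cons, List.mem_append, List.mem_cons, ← hf] at hmem
      rcases hmem with hm | hm | hm
      · exact absurd (List.mem_append_left _ (List.mem_map_of_mem (f := Prod.fst) hm)) hnv
      · exact absurd (List.mem_append_right _ (by simp [(Prod.mk.inj hm).1])) hnv
      · obtain ⟨l₁, l₂, hl, hr⟩ := mem_walk hm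
        refine ⟨l₁ ++ [b], l₂, by simpa using hl, ?_⟩
        rw [runState_append, runState_append, hr, hc]
  obtain ⟨c₁, c₂, hG, hc⟩ := key (List.ofFn s0)
  rw [runState_ofFn] at hc
  exact hno c₁ c₂ hG (hc ▸ visits_start s0 y)

end Splitting

section Types

variable {A : Type*} [Fintype A] [DecidableEq A]

theorem mem_lists {n : ℕ} {x : List A} : x ∈ lists A n ↔ x.length = n := by
  induction n generalizing x with
  | zero => simp [lists]
  | succ n ih => cases x <;> simp [lists, ih]

variable [Inhabited A] {k : ℕ} {s0 : Fin k → A} {M : ℕ}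

theorem mem_typeClassL {x y : List A} :
    y ∈ typeClassL k s0 x ↔ (walk s0 x).Perm (walk s0 y) := by
  rw [typeClassL, mem_sfilter, mem_lists, sameTypeL_iff]
  refine ⟨And.right, fun h => ⟨?_, h⟩⟩
  simpa using h.length_eq.symm

theorem typeClassL_congr {x y : List A} (h : (walk s0 x).Perm (walk s0 y)) :
    typeClassL k s0 x = typeClassL k s0 y := by
  ext z
  rw [mem_typeClassL, mem_typeClassL]
  exact ⟨h.symm.trans, h.trans⟩

theorem BigType.of_perm {x y : List A} (h : (walk s0 x).Perm (walk s0 y))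
    (hx : BigType k s0 M x) : BigType k s0 M y := by
  unfold BigType at *
  rwa [← typeClassL_congr h]

theorem mem_TcutSet {x y : List A} {σ : Fin k → A} {b : A} :
    y ∈ TcutSet k s0 (typeClassL k s0 x) (List.ofFn σ ++ [b]) ↔
      runState s0 y = σ ∧
        (walk s0 x).Perm (walk s0 (y ++ b :: List.ofFn (runState s0 x))) := by
  simp only [TcutSet, Finset.mem_image, mem_sfilter, mem_typeClassL]
  constructor
  · rintro ⟨z, ⟨hz, hlen, hc⟩, rfl⟩
    obtain ⟨y, c, hy, hy'⟩ := exists_split_of_length_le (s0 := s0) (z := z) (k := k)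
      (by simpa using hlen)
    have hl : (List.ofFn σ ++ [b]).length = k + 1 := by simp
    rw [← runState_eq_of_perm hz] at hy
    have hc' := hc
    rw [hy, cut_condition_iff _ _ (by simp)] at hc'
    obtain ⟨h1, rfl⟩ := hc'
    rw [hl, ← hy', ← hy]
    exact ⟨h1, hz⟩
  · rintro ⟨h1, h2⟩
    refine ⟨_, ⟨h2, by simp, (cut_condition_iff _ _ (by simp) _ _ _).2 ⟨h1, rfl⟩⟩, ?_⟩
    simp

theorem bigType_iff {x : List A} :
    BigType k s0 M x ↔ ∀ (σ : Fin k → A) (b : A),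
      M ≤ (TcutSet k s0 (typeClassL k s0 x) (List.ofFn σ ++ [b])).card := by
  refine ⟨fun h σ b => h _ (by simp), fun h u hu => ?_⟩
  obtain ⟨v, b, rfl⟩ : ∃ v b, u = v ++ [b] := by
    rcases List.eq_nil_or_concat' u with rfl | h
    · simp at hu
    · exact h
  have hv : v.length = k := by simpa using hu
  subst hv
  simpa using h v.get b

theorem BigType.mem_walk (hM : 0 < M) {x : List A} (h : BigType k s0 M x)
    (σ : Fin k → A) (b : A) : (σ, b) ∈ walk s0 x := by
  obtain ⟨y, hy⟩ := Finset.card_pos.1 (hM.trans_le (bigType_iff.1 h σ b))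
  obtain ⟨rfl, hp⟩ := mem_TcutSet.1 hy
  rw [hp.mem_iff]
  simp

/-- If some member of the type class of `x ++ [a]` has a prefix with big type, then the type
class of `x` has at least `M` elements. -/
theorem le_card_typeClassL_of_bigType_prefix (hM : 0 < M) {x z w : List A} {a : A}
    (hz : (walk s0 (x ++ [a])).Perm (walk s0 (z ++ w))) (hbig : BigType k s0 M z) :
    M ≤ (typeClassL k s0 x).card := by
  set s := runState s0 x with hs
  set g := runState s0 z with hg
  set f := stepState s a with hf
  have hgw : runState g w = f := by
    simpa [hs, hg, hf] using (runState_eq_of_perm hz).symm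
  have hcard := bigType_iff.1 hbig s a
  obtain ⟨y₀, hy₀⟩ := Finset.card_pos.1 (hM.trans_le hcard)
  obtain ⟨hr₀, hp₀⟩ := mem_TcutSet.1 hy₀
  obtain ⟨c₁, c₂, hG, hv⟩ := exists_visits_of_forall_mem_walk
    (fun σ b => hp₀.mem_iff.1 (hbig.mem_walk hM σ b))
  rw [hr₀, ← hf] at hv
  rw [← hg] at hp₀ hG
  set q := runState f c₁ with hq
  have hqc : runState q c₂ = g := by
    rw [hq, ← runState_append, ← hG, runState_ofFn]
  have hloop : runState q (c₂ ++ w ++ c₁) = q := by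
    rw [runState_append, runState_append, hqc, hgw]
  refine hcard.trans (Finset.card_le_card_of_injOn (insertLoop q (c₂ ++ w ++ c₁) s0) ?_
    (insertLoop_injective _ _ _).injOn)
  intro y hy
  obtain ⟨hr, hp⟩ := mem_TcutSet.1 hy
  rw [← hg] at hp
  have hyy : (walk s0 y₀).Perm (walk s0 y) := by
    have := hp₀.symm.trans hp
    rw [walk_append, walk_append, hr, hr₀] at this
    exact (List.perm_append_right_iff _).1 this
  obtain ⟨-, h2⟩ := insertLoop_spec hloop (hv.of_perm hyy)
  have hxw := hz.trans (walk_append_perm hp w)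
  rw [hG] at hxw
  refine mem_typeClassL.2 ?_
  simp only [walk_append, walk_cons, walk_nil, runState_append, runState_cons, hr, ← hs, ← hf,
    ← hq, hqc] at hxw
  refine (List.perm_append_right_iff [(s, a)]).1 (hxw.trans ?_)
  refine List.Perm.trans ?_ (h2.symm.append_right _)
  simp only [walk_append, runState_append, hqc, hgw]
  rw [List.perm_iff_count]
  intro e
  simp only [List.count_append, List.count_cons, List.count_nil]
  ring

/-- No proper prefix of `x` has big type. -/
def NoBigProperPrefix (k : ℕ) (s0 : Fin k → A) (M : ℕ) (x : List A) : Prop :=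
  ∀ y : List A, y <+: x → y ≠ x → ¬ BigType k s0 M y

theorem not_bigType_nil (hM : 0 < M) : ¬ BigType k s0 M [] := fun h => by
  simpa using h.mem_walk hM s0 default

theorem noBigProperPrefix_append_singleton {x : List A} {a : A} :
    NoBigProperPrefix k s0 M (x ++ [a]) ↔
      NoBigProperPrefix k s0 M x ∧ ¬ BigType k s0 M x := by
  constructor
  · intro h
    have hx := List.prefix_append x [a]
    refine ⟨fun y hy _ => h y (hy.trans hx) ?_, h x hx (by simp)⟩
    rintro rfl
    simpa using hy.length_le
  · rintro ⟨h1, h2⟩ y hy hne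
    rcases List.prefix_concat_iff.1 hy with rfl | hy
    · exact absurd rfl hne
    · by_cases hyx : y = x
      · exact hyx ▸ h2
      · exact h1 y hy hyx

theorem le_card_noBigProperPrefix (hM : 0 < M) (x : List A)
    (hx : NoBigProperPrefix k s0 M x)
    (hz : ∃ z ∈ typeClassL k s0 x, ∃ y, y <+: z ∧ BigType k s0 M y) :
    M ≤ (sfilter (NoBigProperPrefix k s0 M) (typeClassL k s0 x)).card := by
  induction x using List.reverseRecOn with
  | nil =>
    obtain ⟨z, hz, y, hy, hbig⟩ := hz
    have hz0 : z = [] := by simpa using (mem_typeClassL.1 hz).length_eq.symm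
    subst hz0
    rw [List.prefix_nil.1 hy] at hbig
    exact absurd hbig (not_bigType_nil hM)
  | append_singleton x a ih =>
    obtain ⟨z, hz, y, ⟨w, rfl⟩, hbig⟩ := hz
    obtain ⟨hx1, hx2⟩ := noBigProperPrefix_append_singleton.1 hx
    have hcard := le_card_typeClassL_of_bigType_prefix hM (mem_typeClassL.1 hz) hbig
    have hprev : M ≤ (sfilter (NoBigProperPrefix k s0 M) (typeClassL k s0 x)).card := by
      by_cases h : ∃ z ∈ typeClassL k s0 x, ∃ y, y <+: z ∧ BigType k s0 M y
      · exact ih hx1 h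
      · push Not at h
        refine hcard.trans (Finset.card_le_card fun z hz => mem_sfilter.2 ⟨hz, ?_⟩)
        exact fun y hy _ => h z hz y hy
    refine hprev.trans (Finset.card_le_card_of_injOn (· ++ [a]) ?_
      (List.append_left_injective [a]).injOn)
    intro y hy
    obtain ⟨hy1, hy2⟩ := mem_sfilter.1 hy
    have hp := mem_typeClassL.1 hy1
    exact mem_sfilter.2 ⟨mem_typeClassL.2 (walk_append_perm hp [a]),
      noBigProperPrefix_append_singleton.2 ⟨hy2, fun hb => hx2 (hb.of_perm hp.symm)⟩⟩

theorem exists_bigType_append (hA : 2 ≤ Fintype.card A) (z : List A) :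
    ∃ w, BigType k s0 M (z ++ w) := by
  let o : A := default
  obtain ⟨b, hb⟩ := Fintype.exists_ne_of_one_lt_card hA o
  let q : Fin k → A := fun _ => o
  let O : List A := List.ofFn q
  have hO : ∀ s : Fin k → A, runState s O = q := fun s => runState_ofFn s q
  let F : (Fin k → A) × A → List A := fun u => List.ofFn u.1 ++ u.2 :: O
  have hF : ∀ u s, runState s (F u) = q := fun u s => by simp [F, hO]
  have ho : runState q [o] = q := by
    funext i
    simp [q, stepState]
  let U : List ((Fin k → A) × A) := Finset.univ.toList
  let Ls : List (List A) := List.replicate M [o] ++ [b :: O] ++ U.map F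
  have hLs : ∀ l ∈ Ls, runState q l = q := by
    intro l hl
    simp only [Ls, List.mem_append, List.mem_replicate, List.mem_singleton, List.mem_map] at hl
    rcases hl with (⟨-, rfl⟩ | rfl) | ⟨u, -, rfl⟩
    · exact ho
    · simp [hO]
    · exact hF u q
  refine ⟨O ++ Ls.flatten, bigType_iff.2 fun σ c => ?_⟩
  have hrun : runState s0 (z ++ (O ++ Ls.flatten)) = q := by
    rw [runState_append, runState_append, hO, runState_flatten hLs]
  let R : List (List A) := (U.erase (σ, c)).map F
  let Y : ℕ → List A := fun i =>
    z ++ (O ++ (List.replicate i o ++ b :: (O ++ (List.replicate (M - i) o ++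
      (R.flatten ++ List.ofFn σ)))))
  have hcard : (Finset.range M).card = M := Finset.card_range M
  rw [← hcard]
  refine Finset.card_le_card_of_injOn Y ?_ ?_
  · intro i hi
    have hi : i < M := by simpa using hi
    refine mem_TcutSet.2 ⟨by simp only [Y, runState_append, runState_cons, runState_ofFn], ?_⟩
    rw [hrun]
    let Ls' : List (List A) :=
      List.replicate i [o] ++ ([b :: O] ++ (List.replicate (M - i) [o] ++ (R ++ [F (σ, c)])))
    have hY : Y i ++ c :: List.ofFn q = z ++ (O ++ Ls'.flatten) := by
      simp [Y, Ls', F, O]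
    have hperm : Ls.Perm Ls' := by
      have h1 : (U.map F).Perm (R ++ [F (σ, c)]) := by
        refine ((List.perm_cons_erase (a := (σ, c)) (by simp [U])).map F).trans ?_
        rw [List.map_cons]
        exact (List.perm_append_singleton _ _).symm
      have h2 : (List.replicate M [o]).Perm (List.replicate i [o] ++ List.replicate (M - i) [o]) := by
        rw [← List.replicate_add, Nat.add_sub_cancel' hi.le]
      refine ((h2.append_right _).append h1).trans ?_
      rw [List.perm_iff_count]
      intro e
      simp only [Ls', List.count_append]
      ring
    rw [hY]
    simp only [walk_append, hO]
    exact ((walk_flatten_perm hperm hLs).append_left _).append_left _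
  · intro i _ j _ h
    exact replicate_append_cons_inj hb
      (List.append_cancel_left (List.append_cancel_left h))

theorem exists_mem_Dtilde_prefix {x : List A} (hx : BigType k s0 M x) :
    ∃ y ∈ Dtilde k s0 M, y <+: x := by
  induction hn : x.length using Nat.strong_induction_on generalizing x with
  | _ n ih =>
    by_cases h : NoBigProperPrefix k s0 M x
    · exact ⟨x, ⟨hx, h⟩, List.prefix_rfl⟩
    · unfold NoBigProperPrefix at h
      push Not at h
      obtain ⟨y, hyx, hne, hy⟩ := h
      have hlt : y.length < n :=
        hn ▸ lt_of_le_of_ne hyx.length_le fun h => hne (hyx.eq_of_length h)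
      obtain ⟨y', hy', hpre⟩ := ih _ hlt hy rfl
      exact ⟨y', hy', hpre.trans hyx⟩

theorem completeDict_Dtilde (hA : 2 ≤ Fintype.card A) : CompleteDict (Dtilde k s0 M) := by
  refine ⟨fun x hx y hy hxy => by_contra fun hne => hy.2 x hxy hne hx.1, fun z => ?_⟩
  obtain ⟨w, hw⟩ := exists_bigType_append (k := k) (s0 := s0) (M := M) hA z
  obtain ⟨y, hy, hpre⟩ := exists_mem_Dtilde_prefix hw
  rcases List.prefix_or_prefix_of_prefix hpre (List.prefix_append z w) with h | h
  · exact .inl ⟨y, hy, h⟩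
  · exact .inr ⟨y, hy, h⟩

end Types

/-- `D̃` is a complete prefix-free dictionary, and for every
`x ∈ D̃` the number of dictionary strings of the same type as `x` is at least `M`. -/
theorem Dtilde_type_availability {A : Type*} [Fintype A] [DecidableEq A] [Inhabited A]
    (hA : 2 ≤ Fintype.card A) (k : ℕ) (s0 : Fin k → A) (M : ℕ) (hM : 2 ≤ M) :
    CompleteDict (Dtilde k s0 M) ∧
    ∀ x ∈ Dtilde k s0 M,
      M ≤ (sfilter (fun y => y ∈ Dtilde k s0 M) (typeClassL k s0 x)).card := by
  refine ⟨completeDict_Dtilde hA, fun x hx => ?_⟩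
  refine (le_card_noBigProperPrefix (by omega) x hx.2
    ⟨x, mem_typeClassL.2 (.refl _), x, List.prefix_rfl, hx.1⟩).trans
    (Finset.card_le_card fun y hy => ?_)
  obtain ⟨hy1, hy2⟩ := mem_sfilter.1 hy
  exact mem_sfilter.2 ⟨hy1, hx.1.of_perm (mem_typeClassL.1 hy1), hy2⟩
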